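/- Graph cut partition bound: for any undirected graph G = (V, E) with maximum degree Δ and any integer k ≤ |V|, there exists a partition of V into k nonempty parts V_1,...,V_k such that for all i, j, |δ(V_i) − δ(V_j)| ≤ Δ, where δ(S) is the number of edges with exactly one endpoint in S. -/

import Mathlib

def IsPartition {ι α : Type*} (A : ι → Finset α) : Prop :=
  ∀ x : α, ∃! i, x ∈ A i

/-- The cut value of `S`: the number of edges of `G` with exactly one endpoint
in `S` (counted via ordered adjacent pairs whose first coordinate is in `S`
and second is not, which counts each cut edge exactly once). -/
def cutVal {V : Type*} [Fintype V] [DecidableEq V]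
    (G : SimpleGraph V) [DecidableRel G.Adj] (S : Finset V) : ℕ :=
  (Finset.univ.filter (fun p : V × V => G.Adj p.1 p.2 ∧ p.1 ∈ S ∧ p.2 ∉ S)).card

theorem cutVal_insert_le {V : Type*} [Fintype V] [DecidableEq V]
    (G : SimpleGraph V) [DecidableRel G.Adj] (v : V) (S : Finset V) :
    cutVal G (insert v S) ≤ cutVal G S + G.maxDegree := by
  have hsub : Finset.univ.filter
        (fun p : V × V => G.Adj p.1 p.2 ∧ p.1 ∈ insert v S ∧ p.2 ∉ insert v S) ⊆
      Finset.univ.filter (fun p : V × V => G.Adj p.1 p.2 ∧ p.1 ∈ S ∧ p.2 ∉ S) ∪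
        (G.neighborFinset v).image (fun u => (v, u)) := by
    rintro ⟨a, b⟩ h
    simp only [Finset.mem_filter, Finset.mem_univ, true_and, Finset.mem_insert, not_or,
      Finset.mem_union, Finset.mem_image, SimpleGraph.mem_neighborFinset, Prod.mk.injEq] at h ⊢
    obtain ⟨hab, rfl | ha, -, hb⟩ := h
    · exact Or.inr ⟨b, hab, rfl, rfl⟩
    · exact Or.inl ⟨hab, ha, hb⟩
  refine (Finset.card_le_card hsub).trans ((Finset.card_union_le _ _).trans ?_)
  exact Nat.add_le_add_left (Finset.card_image_le.trans (G.degree_le_maxDegree v)) _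

theorem cutVal_le_insert {V : Type*} [Fintype V] [DecidableEq V]
    (G : SimpleGraph V) [DecidableRel G.Adj] (v : V) (S : Finset V) :
    cutVal G S ≤ cutVal G (insert v S) + G.maxDegree := by
  have hsub : Finset.univ.filter (fun p : V × V => G.Adj p.1 p.2 ∧ p.1 ∈ S ∧ p.2 ∉ S) ⊆
      Finset.univ.filter
        (fun p : V × V => G.Adj p.1 p.2 ∧ p.1 ∈ insert v S ∧ p.2 ∉ insert v S) ∪
        (G.neighborFinset v).image (fun u => (u, v)) := by
    rintro ⟨a, b⟩ h
    simp only [Finset.mem_filter, Finset.mem_univ, true_and, Finset.mem_insert, not_or,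
      Finset.mem_union, Finset.mem_image, SimpleGraph.mem_neighborFinset, Prod.mk.injEq] at h ⊢
    obtain ⟨hab, ha, hb⟩ := h
    by_cases hbv : b = v
    · exact Or.inr ⟨a, hbv ▸ hab.symm, rfl, hbv.symm⟩
    · exact Or.inl ⟨hab, Or.inr ha, hbv, hb⟩
  refine (Finset.card_le_card hsub).trans ((Finset.card_union_le _ _).trans ?_)
  exact Nat.add_le_add_left (Finset.card_image_le.trans (G.degree_le_maxDegree v)) _

namespace IntervalPartition

/-- A value `F x y` for every interval `[x, y)` of naturals is `D`-Lipschitz if moving one endpoint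
by one changes it by at most `D`; empty intervals have value `0`. -/
structure IsLipschitz (F : ℕ → ℕ → ℕ) (D : ℕ) : Prop where
  self : ∀ x, F x x = 0
  right_le : ∀ x y, F x (y + 1) ≤ F x y + D
  le_right : ∀ x y, F x y ≤ F x (y + 1) + D
  left_le : ∀ x y, F (x + 1) y ≤ F x y + D
  le_left : ∀ x y, F x y ≤ F (x + 1) y + D

/-- The interval `[x, y)` is nonempty and its value lies in the window `[t - D, t]`. -/
def Good (F : ℕ → ℕ → ℕ) (D x y t : ℕ) : Prop :=
  x < y ∧ D ≤ t ∧ F x y ≤ t ∧ t ≤ F x y + D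

/-- `[0, y)` can be cut into `j + 1` consecutive good intervals for the window `[t - D, t]`. -/
def Splits (F : ℕ → ℕ → ℕ) (D : ℕ) : ℕ → ℕ × ℕ → Prop
  | 0, p => Good F D 0 p.1 p.2
  | j + 1, p => ∃ x, Splits F D j (x, p.2) ∧ Good F D x p.1 p.2

/-- Grid points that agree in one coordinate and differ by at most one in the other. -/
def Near (p q : ℕ × ℕ) : Prop :=
  (p.1 = q.1 ∧ p.2 ≤ q.2 + 1 ∧ q.2 ≤ p.2 + 1) ∨ (p.2 = q.2 ∧ p.1 ≤ q.1 + 1 ∧ q.1 ≤ p.1 + 1)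

theorem Near.symm {p q : ℕ × ℕ} (h : Near p q) : Near q p := by
  unfold Near at *; omega

/-- Reachability by unit steps inside `Splits F D j`, from the splitting into singletons. -/
def Reach (F : ℕ → ℕ → ℕ) (D j : ℕ) : ℕ × ℕ → Prop :=
  Relation.ReflTransGen (fun p q => Splits F D j p ∧ Splits F D j q ∧ Near p q) (j + 1, D)

variable {F : ℕ → ℕ → ℕ} {D : ℕ}

theorem IsLipschitz.singleton_le (hF : IsLipschitz F D) (x : ℕ) : F x (x + 1) ≤ D := by
  have := hF.right_le x x
  rw [hF.self] at this
  omega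

theorem IsLipschitz.good_singleton (hF : IsLipschitz F D) (x : ℕ) : Good F D x (x + 1) D :=
  ⟨by omega, le_rfl, hF.singleton_le x, by omega⟩

theorem IsLipschitz.splits_start (hF : IsLipschitz F D) (j : ℕ) : Splits F D j (j + 1, D) := by
  induction j with
  | zero => exact hF.good_singleton 0
  | succ j ih => exact ⟨j + 1, ih, hF.good_singleton _⟩

theorem Reach.splits (hF : IsLipschitz F D) {j : ℕ} {p : ℕ × ℕ} (h : Reach F D j p) :
    Splits F D j p := by
  rcases Relation.ReflTransGen.cases_tail h with h | ⟨_, _, h⟩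
  · exact h ▸ hF.splits_start j
  · exact h.2.1

theorem Reach.step (hF : IsLipschitz F D) {j : ℕ} {p q : ℕ × ℕ} (h : Reach F D j p)
    (hq : Splits F D j q) (hpq : Near p q) : Reach F D j q :=
  Relation.ReflTransGen.tail h ⟨h.splits hF, hq, hpq⟩

open Classical in
/-- The colour of the interval `[x, y)` at level `t`: `0` if it is good and `(y, t)` is reachable,
`1` if it is good and `(y, t)` is not reachable, `2` if its value is too high, and
`3` if its value is too low or it is empty. -/
noncomputable def colour (F : ℕ → ℕ → ℕ) (D j x t y : ℕ) : Fin 4 :=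
  if Good F D x y t then (if Reach F D j (y, t) then 0 else 1)
  else if x < y ∧ t < F x y then 2 else 3

theorem colour_eq_zero {j x t y : ℕ} :
    colour F D j x t y = 0 ↔ Good F D x y t ∧ Reach F D j (y, t) := by
  unfold colour; split_ifs <;> simp_all

theorem colour_eq_one {j x t y : ℕ} :
    colour F D j x t y = 1 ↔ Good F D x y t ∧ ¬ Reach F D j (y, t) := by
  unfold colour; split_ifs <;> simp_all

theorem colour_eq_two {j x t y : ℕ} :
    colour F D j x t y = 2 ↔ x < y ∧ t < F x y := by
  unfold colour Good; split_ifs <;> simp_all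

theorem colour_eq_three {j x t y : ℕ} :
    colour F D j x t y = 3 ↔ ¬ Good F D x y t ∧ ¬ (x < y ∧ t < F x y) := by
  unfold colour; split_ifs <;> simp_all

/-- Two colours which do not witness a jump from too high to too low. -/
def NoJump (a b : Fin 4) : Prop := ¬ (a = 2 ∧ b = 3) ∧ ¬ (a = 3 ∧ b = 2)

/-- Two colours which do not witness a step from a reachable to an unreachable good interval. -/
def NoLeave (a b : Fin 4) : Prop := ¬ (a = 0 ∧ b = 1) ∧ ¬ (a = 1 ∧ b = 0)

instance (a b : Fin 4) : Decidable (NoJump a b) := by unfold NoJump; infer_instance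

instance (a b : Fin 4) : Decidable (NoLeave a b) := by unfold NoLeave; infer_instance

/-- Indicator of a door: one colour is `0` (reachable), the other is `2` (too high). -/
def door (a b : Fin 4) : ZMod 2 := if (a = 0 ∧ b = 2) ∨ (a = 2 ∧ b = 0) then 1 else 0

theorem door_square : ∀ a b c d : Fin 4,
    NoJump a b → NoJump b c → NoJump c d → NoJump d a →
    NoLeave a b → NoLeave b c → NoLeave c d → NoLeave d a →
    ((NoJump a c ∧ NoJump b d) ∨ (NoLeave a c ∧ NoLeave b d)) →
    door a b + door b c + door c d + door d a = 0 := by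
  decide

theorem not_high_low (hF : IsLipschitz F D) {j x t y x' t' y' : ℕ} (hD : D ≤ t) (hD' : D ≤ t')
    (h : (x = x' ∧ (t ≤ t' + 1 ∧ t' ≤ t + 1) ∧ y ≤ y' + 1 ∧ y' ≤ y + 1) ∨
      (t = t' ∧ y = y' ∧ x ≤ x' + 1 ∧ x' ≤ x + 1)) :
    ¬ (colour F D j x t y = 2 ∧ colour F D j x' t' y' = 3) := by
  rw [colour_eq_two, colour_eq_three]
  rintro ⟨⟨hxy, hH⟩, hG, hL⟩
  have hy : y ≠ x + 1 := by
    rintro rfl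
    have := hF.singleton_le x
    omega
  have hFF : F x y ≤ F x' y' + D := by
    rcases h with ⟨rfl, -, h1, h2⟩ | ⟨-, rfl, h1, h2⟩
    · have : y' = y ∨ y' = y + 1 ∨ y = y' + 1 := by omega
      rcases this with rfl | rfl | rfl
      · omega
      · exact hF.le_right _ _
      · exact hF.right_le _ _
    · have : x' = x ∨ x' = x + 1 ∨ x = x' + 1 := by omega
      rcases this with rfl | rfl | rfl
      · omega
      · exact hF.le_left _ _
      · exact hF.left_le _ _
  unfold Good at hG
  omega

theorem noJump (hF : IsLipschitz F D) {j x t y x' t' y' : ℕ} (hD : D ≤ t) (hD' : D ≤ t')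
    (h : (x = x' ∧ (t ≤ t' + 1 ∧ t' ≤ t + 1) ∧ y ≤ y' + 1 ∧ y' ≤ y + 1) ∨
      (t = t' ∧ y = y' ∧ x ≤ x' + 1 ∧ x' ≤ x + 1)) :
    NoJump (colour F D j x t y) (colour F D j x' t' y') :=
  ⟨not_high_low hF hD hD' h, fun h' => not_high_low hF hD' hD (by omega) h'.symm⟩

theorem noLeave (hF : IsLipschitz F D) {j x t y x' t' y' : ℕ} (hx : Splits F D j (x, t))
    (hx' : Splits F D j (x', t')) (h : Near (y, t) (y', t')) :
    NoLeave (colour F D (j + 1) x t y) (colour F D (j + 1) x' t' y') := by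
  constructor <;> rw [colour_eq_zero, colour_eq_one]
  · rintro ⟨⟨_, hr⟩, hg, hn⟩
    exact hn (hr.step hF ⟨x', hx', hg⟩ h)
  · rintro ⟨⟨hg, hn⟩, _, hr⟩
    exact hn (hr.step hF ⟨x, hx, hg⟩ h.symm)

/-- The number of doors, modulo 2, among the intervals starting at `x` and ending at most at `m`. -/
noncomputable def doors (F : ℕ → ℕ → ℕ) (D j x t m : ℕ) : ZMod 2 :=
  ∑ y ∈ Finset.range m, door (colour F D j x t y) (colour F D j x t (y + 1))

theorem Splits.le_level {j : ℕ} {p : ℕ × ℕ} (h : Splits F D j p) : D ≤ p.2 := by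
  cases j with
  | zero => exact h.2.1
  | succ j => obtain ⟨_, _, h⟩ := h; exact h.2.1

theorem doors_add_doors (hF : IsLipschitz F D) {j x t x' t' : ℕ} (hx : Splits F D j (x, t))
    (hx' : Splits F D j (x', t')) (h : Near (x, t) (x', t')) (m : ℕ) :
    doors F D (j + 1) x t m + doors F D (j + 1) x' t' m =
      door (colour F D (j + 1) x t m) (colour F D (j + 1) x' t' m) := by
  have hD : D ≤ t := hx.le_level
  have hD' : D ≤ t' := hx'.le_level
  induction m with
  | zero =>
    have h0 : ∀ x t, colour F D (j + 1) x t 0 = 3 := fun x t =>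
      colour_eq_three.2 ⟨fun h => absurd h.1 (by omega), fun h => absurd h.1 (by omega)⟩
    simp [doors, h0, door]
  | succ m ih =>
    have hsq : door (colour F D (j + 1) x t m) (colour F D (j + 1) x t (m + 1)) +
        door (colour F D (j + 1) x t (m + 1)) (colour F D (j + 1) x' t' (m + 1)) +
        door (colour F D (j + 1) x' t' (m + 1)) (colour F D (j + 1) x' t' m) +
        door (colour F D (j + 1) x' t' m) (colour F D (j + 1) x t m) = 0 := by
      unfold Near at h
      dsimp only at h
      apply door_square
      · exact noJump hF hD hD (by omega)
      · exact noJump hF hD hD' (by omega)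
      · exact noJump hF hD' hD' (by omega)
      · exact noJump hF hD' hD (by omega)
      · exact noLeave hF hx hx (by unfold Near; dsimp only; omega)
      · exact noLeave hF hx hx' (by unfold Near; dsimp only; omega)
      · exact noLeave hF hx' hx' (by unfold Near; dsimp only; omega)
      · exact noLeave hF hx' hx (by unfold Near; dsimp only; omega)
      · rcases h with h | h
        · exact Or.inl ⟨noJump hF hD hD' (by omega), noJump hF hD hD' (by omega)⟩
        · exact Or.inr ⟨noLeave hF hx hx' (by unfold Near; dsimp only; omega),
            noLeave hF hx hx' (by unfold Near; dsimp only; omega)⟩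
    unfold doors at ih ⊢
    rw [Finset.sum_range_succ, Finset.sum_range_succ]
    have hcomm : ∀ a b, door a b = door b a := by decide
    rw [hcomm (colour F D (j + 1) x' t' (m + 1)) (colour F D (j + 1) x' t' m),
      hcomm (colour F D (j + 1) x' t' m) (colour F D (j + 1) x t m)] at hsq
    have htwo : (2 : ZMod 2) = 0 := by decide
    linear_combination ih + hsq -
      door (colour F D (j + 1) x t (m + 1)) (colour F D (j + 1) x' t' (m + 1)) * htwo

theorem doors_start (hF : IsLipschitz F D) (j m : ℕ) :
    doors F D (j + 1) (j + 1) D m =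
      if j + 1 < m ∧ colour F D (j + 1) (j + 1) D m ≠ 0 then 1 else 0 := by
  induction m with
  | zero => simp [doors]
  | succ m ih =>
    unfold doors at ih ⊢
    rw [Finset.sum_range_succ, ih]
    rcases lt_trichotomy m (j + 1) with hm | rfl | hm
    · have h3 : colour F D (j + 1) (j + 1) D m = 3 :=
        colour_eq_three.2 ⟨fun h => absurd h.1 (by omega), fun h => absurd h.1 (by omega)⟩
      rw [h3, if_neg (by omega), if_neg (by omega)]
      simp [door]
    · have h3 : colour F D (j + 1) (j + 1) D (j + 1) = 3 :=
        colour_eq_three.2 ⟨fun h => absurd h.1 (by omega), fun h => absurd h.1 (by omega)⟩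
      have h0 : colour F D (j + 1) (j + 1) D (j + 1 + 1) = 0 :=
        colour_eq_zero.2 ⟨hF.good_singleton _, Relation.ReflTransGen.refl⟩
      rw [h3, h0]
      simp [door]
    · have hne : ∀ y, j + 1 < y → colour F D (j + 1) (j + 1) D y ≠ 3 := by
        intro y hy h
        rw [colour_eq_three] at h
        unfold Good at h
        omega
      have hs := hF.splits_start j
      have hl := noLeave (y := m) (y' := m + 1) hF hs hs (by unfold Near; dsimp only; omega)
      have h1 := hne m hm
      have h2 := hne (m + 1) (by omega)
      simp only [hm, show j + 1 < m + 1 by omega, true_and]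
      generalize colour F D (j + 1) (j + 1) D m = a at *
      generalize colour F D (j + 1) (j + 1) D (m + 1) = b at *
      clear ih hne hs
      revert a b
      decide

theorem exists_reach_zero (hF : IsLipschitz F D) (m : ℕ) : ∃ t, Reach F D 0 (m + 1, t) := by
  induction m with
  | zero => exact ⟨D, Relation.ReflTransGen.refl⟩
  | succ m ih =>
    obtain ⟨t, ht⟩ := ih
    have hs : Good F D 0 (m + 1) t := ht.splits hF
    have h1 := hF.right_le 0 (m + 1)
    have h2 := hF.le_right 0 (m + 1)
    have hgood : ∀ u, D ≤ u → F 0 (m + 1) ≤ u → u ≤ F 0 (m + 1) + D →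
        Splits F D 0 (m + 1, u) := fun u ha hb hc => ⟨by simp, ha, hb, hc⟩
    obtain ⟨hs0, hs1, hs2, hs3⟩ := hs
    have hup : ∀ i, t + i ≤ F 0 (m + 1) + D → Reach F D 0 (m + 1, t + i) := by
      intro i
      induction i with
      | zero => exact fun _ => ht
      | succ i ih =>
        intro hi
        exact (ih (by omega)).step hF (hgood _ (by omega) (by omega) (by omega))
          (by unfold Near; dsimp only; omega)
    have htop := hup (F 0 (m + 1) + D - t) (by omega)
    rw [show t + (F 0 (m + 1) + D - t) = F 0 (m + 1) + D by omega] at htop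
    have hdown : ∀ i, D ≤ F 0 (m + 1) + D - i → i ≤ D →
        Reach F D 0 (m + 1, F 0 (m + 1) + D - i) := by
      intro i
      induction i with
      | zero => exact fun _ _ => htop
      | succ i ih =>
        intro hi hi'
        exact (ih (by omega) (by omega)).step hF (hgood _ (by omega) (by omega) (by omega))
          (by unfold Near; dsimp only; omega)
    by_cases hle : F 0 (m + 1) ≤ F 0 (m + 1 + 1)
    · exact ⟨_, htop.step hF (q := (m + 1 + 1, F 0 (m + 1) + D))
        ⟨by simp, by omega, by dsimp only; omega, by dsimp only; omega⟩
        (by unfold Near; dsimp only; omega)⟩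
    · have := hdown (F 0 (m + 1) - F 0 (m + 1 + 1)) (by omega) (by omega)
      rw [show F 0 (m + 1) + D - (F 0 (m + 1) - F 0 (m + 1 + 1)) = F 0 (m + 1 + 1) + D by
        omega] at this
      exact ⟨_, this.step hF (q := (m + 1 + 1, F 0 (m + 1 + 1) + D))
        ⟨by simp, by dsimp only; omega, by dsimp only; omega, by dsimp only; omega⟩
        (by unfold Near; dsimp only; omega)⟩

theorem exists_reach (hF : IsLipschitz F D) (j m : ℕ) (hm : j < m) : ∃ t, Reach F D j (m, t) := by
  induction j generalizing m with
  | zero =>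
    obtain ⟨m, rfl⟩ : ∃ i, m = i + 1 := ⟨m - 1, by omega⟩
    exact exists_reach_zero hF m
  | succ j ih =>
    obtain ⟨m, rfl⟩ : ∃ i, m = i + 1 := ⟨m - 1, by omega⟩
    obtain ⟨t, ht⟩ := ih m (by omega)
    by_contra! hno
    have hne : ∀ x t, colour F D (j + 1) x t (m + 1) ≠ 0 := fun x t h =>
      hno t (colour_eq_zero.1 h).2
    have hone : ∀ p, Reach F D j p → doors F D (j + 1) p.1 p.2 (m + 1) = 1 := by
      intro p hp
      induction hp with
      | refl => rw [doors_start hF, if_pos ⟨by omega, hne _ _⟩]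
      | tail _ hstep ih =>
        have h := doors_add_doors hF hstep.1 hstep.2.1 hstep.2.2 (m + 1)
        have hdoor : ∀ a b : Fin 4, a ≠ 0 → b ≠ 0 → door a b = 0 := by decide
        rw [ih, hdoor _ _ (hne _ _) (hne _ _)] at h
        generalize doors _ _ _ _ _ _ = a at h ⊢
        revert a
        decide
    have hzero : doors F D (j + 1) m t (m + 1) = 0 := by
      have hlow : ∀ y ≤ m + 1, colour F D (j + 1) m t y ≠ 2 := by
        intro y hy h
        obtain ⟨h1, h2⟩ := colour_eq_two.1 h
        obtain rfl : y = m + 1 := by omega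
        have h3 := hF.singleton_le m
        have h4 : D ≤ t := (ht.splits hF).le_level
        omega
      refine Finset.sum_eq_zero fun y hy => ?_
      have hdoor : ∀ a b : Fin 4, a ≠ 2 → b ≠ 2 → door a b = 0 := by decide
      rw [Finset.mem_range] at hy
      exact hdoor _ _ (hlow _ (by omega)) (hlow _ (by omega))
    have := hone _ ht
    rw [hzero] at this
    exact absurd this (by decide)

/-- The parts of a splitting, encoded by the function sending a point to the index of its part. -/
theorem Splits.exists_index {j y t : ℕ} (h : Splits F D j (y, t)) :
    ∃ g : ℕ → ℕ, (∀ u < y, g u ≤ j) ∧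
      ∀ i ≤ j, ∃ a b, Good F D a b t ∧ b ≤ y ∧ ∀ u < y, (g u = i ↔ a ≤ u ∧ u < b) := by
  induction j generalizing y with
  | zero =>
    exact ⟨fun _ => 0, fun _ _ => le_rfl, fun i hi => ⟨0, y, h, le_rfl, fun u hu => by dsimp only; omega⟩⟩
  | succ j ih =>
    obtain ⟨x, hx, hg⟩ := h
    obtain ⟨g, hgj, hgi⟩ := ih hx
    have hxy : x < y := hg.1
    refine ⟨fun u => if u < x then g u else j + 1, ?_, ?_⟩
    · intro u _
      dsimp only
      split_ifs with hu
      · exact (hgj u hu).trans (Nat.le_succ j)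
      · exact le_rfl
    · intro i hi
      rcases Nat.lt_or_ge j i with hij | hij
      · refine ⟨x, y, hg, le_rfl, fun u hu => ?_⟩
        dsimp only
        split_ifs with hux
        · have := hgj u hux
          omega
        · omega
      · obtain ⟨a, b, hab, hb, hu⟩ := hgi i hij
        refine ⟨a, b, hab, by omega, fun u _ => ?_⟩
        dsimp only
        split_ifs with hux
        · exact hu u hux
        · omega

end IntervalPartition

open IntervalPartition in
/-- For any enumeration of the vertices, the cut values of the intervals are Lipschitz. -/
theorem isLipschitz_cutVal {V : Type*} [Fintype V] [DecidableEq V]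
    (G : SimpleGraph V) [DecidableRel G.Adj] (e : V ≃ Fin (Fintype.card V)) :
    IsLipschitz (fun x y => cutVal G (Finset.univ.filter fun v => x ≤ (e v : ℕ) ∧ (e v : ℕ) < y))
      G.maxDegree := by
  have key : ∀ (S T : Finset V) (c : ℕ), (∀ v, (e v : ℕ) ≠ c → (v ∈ S ↔ v ∈ T)) → S ⊆ T →
      cutVal G S ≤ cutVal G T + G.maxDegree ∧ cutVal G T ≤ cutVal G S + G.maxDegree := by
    intro S T c h hST
    by_cases hTS : T ⊆ S
    · rw [hST.antisymm hTS]
      omega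
    · obtain ⟨v, hvT, hvS⟩ := Finset.not_subset.1 hTS
      have hvc : (e v : ℕ) = c := by
        by_contra hne
        exact hvS ((h v hne).2 hvT)
      have hT : T = insert v S := by
        ext w
        rw [Finset.mem_insert]
        constructor
        · intro hw
          by_cases hwc : (e w : ℕ) = c
          · exact Or.inl (e.injective (Fin.ext (hwc.trans hvc.symm)))
          · exact Or.inr ((h w hwc).2 hw)
        · rintro (rfl | hw)
          · exact hvT
          · exact hST hw
      rw [hT]
      exact ⟨cutVal_le_insert G v S, cutVal_insert_le G v S⟩
  have hright : ∀ x y : ℕ, _ := fun x y => key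
    (Finset.univ.filter fun v => x ≤ (e v : ℕ) ∧ (e v : ℕ) < y)
    (Finset.univ.filter fun v => x ≤ (e v : ℕ) ∧ (e v : ℕ) < y + 1) y
    (fun v hv => by simp only [Finset.mem_filter, Finset.mem_univ, true_and]; omega)
    (fun v => by simp only [Finset.mem_filter, Finset.mem_univ, true_and]; omega)
  have hleft : ∀ x y : ℕ, _ := fun x y => key
    (Finset.univ.filter fun v => x + 1 ≤ (e v : ℕ) ∧ (e v : ℕ) < y)
    (Finset.univ.filter fun v => x ≤ (e v : ℕ) ∧ (e v : ℕ) < y) x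
    (fun v hv => by simp only [Finset.mem_filter, Finset.mem_univ, true_and]; omega)
    (fun v => by simp only [Finset.mem_filter, Finset.mem_univ, true_and]; omega)
  refine ⟨fun x => ?_, fun x y => (hright x y).2, fun x y => (hright x y).1,
    fun x y => (hleft x y).1, fun x y => (hleft x y).2⟩
  have hempty : (Finset.univ.filter fun v => x ≤ (e v : ℕ) ∧ (e v : ℕ) < x) = ∅ :=
    Finset.filter_eq_empty_iff.2 fun v _ => by omega
  simp [hempty, cutVal]

/-- For any graph with maximum degree `Δ` and any `1 ≤ k ≤ |V|`, the vertex
set can be partitioned into `k` nonempty parts whose cut values pairwise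
differ by at most `Δ`. -/
theorem cut_partition_bound {V : Type*} [Fintype V] [DecidableEq V]
    (G : SimpleGraph V) [DecidableRel G.Adj]
    (k : ℕ) (hk : 1 ≤ k) (hkV : k ≤ Fintype.card V) :
    ∃ P : Fin k → Finset V, IsPartition P ∧ (∀ i, (P i).Nonempty) ∧
      ∀ i j, |(cutVal G (P i) : ℤ) - (cutVal G (P j) : ℤ)| ≤ (G.maxDegree : ℤ) := by
  have e : V ≃ Fin (Fintype.card V) := Fintype.equivFin V
  have hF := isLipschitz_cutVal G e
  obtain ⟨t, ht⟩ := IntervalPartition.exists_reach hF (k - 1) (Fintype.card V) (by omega)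
  obtain ⟨g, hgk, hgi⟩ := (ht.splits hF).exists_index
  have hpart : ∀ i : Fin k, (Finset.univ.filter fun v => g (e v) = i).Nonempty ∧
      cutVal G (Finset.univ.filter fun v => g (e v) = i) ≤ t ∧
      t ≤ cutVal G (Finset.univ.filter fun v => g (e v) = i) + G.maxDegree := by
    intro i
    obtain ⟨a, b, ⟨hab, -, h1, h2⟩, hb, hu⟩ := hgi i (by omega)
    have heq : (Finset.univ.filter fun v => g (e v) = i) =
        Finset.univ.filter fun v => a ≤ (e v : ℕ) ∧ (e v : ℕ) < b :=
      Finset.filter_congr fun v _ => hu _ (e v).isLt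
    rw [heq]
    refine ⟨⟨e.symm ⟨a, by omega⟩, ?_⟩, h1, h2⟩
    simpa using hab
  refine ⟨fun i => Finset.univ.filter fun v => g (e v) = i, fun v => ?_, fun i => (hpart i).1,
    fun i j => ?_⟩
  · have hv := hgk _ (e v).isLt
    refine ⟨⟨g (e v), by omega⟩, by simp, fun i hi => ?_⟩
    exact Fin.ext (Finset.mem_filter.1 hi).2.symm
  · obtain ⟨-, hi1, hi2⟩ := hpart i
    obtain ⟨-, hj1, hj2⟩ := hpart j
    dsimp only
    rw [abs_le]
    constructor <;> omega
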